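/- The canonical iterates form a pointwise decreasing sequence: for every n ≥ 0 and every x ∈ [0,1], h_{n+1}(x) ≤ h_n(x). -/

import Mathlib

open Set MeasureTheory Polynomial

noncomputable section

/-- The class `E` of antitone functions `g : [0,1] → [0,1]` with `g 0 = 1` and
positive integral (functions are modelled as total functions `ℝ → ℝ`,
constrained on `[0,1]`). -/
def E : Set (ℝ → ℝ) :=
  {g | AntitoneOn g (Icc 0 1) ∧ MapsTo g (Icc 0 1) (Icc 0 1) ∧ g 0 = 1 ∧
    0 < ∫ x in (0:ℝ)..1, g x}

/-- The pseudo-inverse `g*` of `g`, given by `g* y = sup {x ∈ [0,1] | g x ≥ y}`. -/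
def pseudoInv (g : ℝ → ℝ) : ℝ → ℝ := fun y => sSup {x | x ∈ Icc (0:ℝ) 1 ∧ y ≤ g x}

/-- The stribolic operator `T`, `(T g) x = (∫_x^1 g*) / (∫_0^1 g)`. -/
def T (g : ℝ → ℝ) : ℝ → ℝ := fun x =>
  (∫ t in x..(1:ℝ), pseudoInv g t) / (∫ t in (0:ℝ)..1, g t)

/-- The canonical stribolic iterates: `h 0 = 1` and `h (n+1) = T (h n)`. -/
def h : ℕ → ℝ → ℝ
  | 0 => fun _ => 1
  | n + 1 => T (h n)

/-- `κ n = ∫_0^1 h n`. -/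
def κ (n : ℕ) : ℝ := ∫ t in (0:ℝ)..1, h n t

/-- The compositions `q n = h n ∘ ⋯ ∘ h 1`, with `q 0 = id`. -/
def q : ℕ → ℝ → ℝ
  | 0 => fun x => x
  | n + 1 => h (n + 1) ∘ q n

/-- `q (n-1)`, with the convention that for `n = 0` (i.e. "`q (-1)`") it is the
constant function `1` (the only convention making the `n = 0` cases hold). -/
def qprev : ℕ → ℝ → ℝ
  | 0 => fun _ => 1
  | n + 1 => q n

/-- `Q n x = ∫_0^x (q n)' (t) * q (n-1) (t) dt`. -/
def Q (n : ℕ) (x : ℝ) : ℝ := ∫ t in (0:ℝ)..x, deriv (q n) t * qprev n t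

/-- A decreasing homeomorphism of `[0,1]`, presented as a total function on `ℝ`. -/
structure IsDecHomeo (f : ℝ → ℝ) : Prop where
  continuousOn : ContinuousOn f (Icc 0 1)
  strictAntiOn : StrictAntiOn f (Icc 0 1)
  map_zero : f 0 = 1
  map_one : f 1 = 0

/-- No rescaling `x ↦ m * f (l * x)` of `f` goes from below `g` to above `g` and back. -/
def NoReturn (f g : ℝ → ℝ) : Prop :=
  ∀ l m x y z : ℝ, 0 < l → 0 < m → 0 ≤ x → x < y → y < z → z ≤ 1 → l * z ≤ 1 →
    m * f (l * x) < g x → g y < m * f (l * y) → g z ≤ m * f (l * z)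

theorem pseudoInv_antitone (f : ℝ → ℝ) : Antitone (pseudoInv f) := by
  intro y y' hy
  unfold pseudoInv
  rcases Set.eq_empty_or_nonempty {x | x ∈ Icc (0:ℝ) 1 ∧ y' ≤ f x} with he | hne
  · rw [he, Real.sSup_empty]
    exact Real.sSup_nonneg fun x hx => hx.1.1
  · exact csSup_le_csSup ⟨1, fun x hx => hx.1.2⟩ hne fun x hx => ⟨hx.1, hy.trans hx.2⟩

theorem pseudoInv_intervalIntegrable (f : ℝ → ℝ) (a b : ℝ) :
    IntervalIntegrable (pseudoInv f) volume a b :=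
  (pseudoInv_antitone f).intervalIntegrable

theorem setOf_le_apply_eq_Icc {f : ℝ → ℝ} (hf : StrictAntiOn f (Icc 0 1)) {v : ℝ}
    (hv : v ∈ Icc (0:ℝ) 1) : {x | x ∈ Icc (0:ℝ) 1 ∧ f v ≤ f x} = Icc 0 v := by
  ext x
  constructor
  · rintro ⟨hx, hle⟩
    exact ⟨hx.1, (hf.le_iff_ge hv hx).1 hle⟩
  · intro hx
    have hx1 : x ∈ Icc (0:ℝ) 1 := ⟨hx.1, hx.2.trans hv.2⟩
    exact ⟨hx1, (hf.le_iff_ge hv hx1).2 hx.2⟩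

theorem pseudoInv_apply {f : ℝ → ℝ} (hf : StrictAntiOn f (Icc 0 1)) {v : ℝ}
    (hv : v ∈ Icc (0:ℝ) 1) : pseudoInv f (f v) = v := by
  rw [pseudoInv, setOf_le_apply_eq_Icc hf hv, csSup_Icc hv.1]

namespace IsDecHomeo

variable {f g : ℝ → ℝ}

theorem exists_apply_eq (hf : IsDecHomeo f) {y : ℝ} (hy : y ∈ Icc (0:ℝ) 1) :
    ∃ v ∈ Icc (0:ℝ) 1, f v = y := by
  have := intermediate_value_Icc' zero_le_one hf.continuousOn
  rw [hf.map_zero, hf.map_one] at this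
  exact this hy

theorem pseudoInv_mem (hf : IsDecHomeo f) {y : ℝ} (hy : y ∈ Icc (0:ℝ) 1) :
    pseudoInv f y ∈ Icc (0:ℝ) 1 := by
  obtain ⟨v, hv, rfl⟩ := hf.exists_apply_eq hy
  rwa [pseudoInv_apply hf.strictAntiOn hv]

theorem apply_pseudoInv (hf : IsDecHomeo f) {y : ℝ} (hy : y ∈ Icc (0:ℝ) 1) :
    f (pseudoInv f y) = y := by
  obtain ⟨v, hv, rfl⟩ := hf.exists_apply_eq hy
  rw [pseudoInv_apply hf.strictAntiOn hv]

theorem pseudoInv_one (hf : IsDecHomeo f) : pseudoInv f 1 = 0 := by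
  have := pseudoInv_apply hf.strictAntiOn (left_mem_Icc.2 zero_le_one)
  rwa [hf.map_zero] at this

theorem pseudoInv_pos (hf : IsDecHomeo f) {y : ℝ} (h0 : 0 ≤ y) (h1 : y < 1) :
    0 < pseudoInv f y := by
  have hm := hf.pseudoInv_mem ⟨h0, h1.le⟩
  refine lt_of_le_of_ne hm.1 fun he => ?_
  have := hf.apply_pseudoInv ⟨h0, h1.le⟩
  rw [← he, hf.map_zero] at this
  linarith

theorem mem_Icc (hf : IsDecHomeo f) {x : ℝ} (hx : x ∈ Icc (0:ℝ) 1) : f x ∈ Icc (0:ℝ) 1 := by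
  have h0 := hf.strictAntiOn.antitoneOn (left_mem_Icc.2 zero_le_one) hx hx.1
  have h1 := hf.strictAntiOn.antitoneOn hx (right_mem_Icc.2 zero_le_one) hx.2
  rw [hf.map_zero] at h0
  rw [hf.map_one] at h1
  exact ⟨h1, h0⟩

theorem integral_pos (hf : IsDecHomeo f) : 0 < ∫ t in (0:ℝ)..1, f t := by
  refine intervalIntegral.intervalIntegral_pos_of_pos_on ?_ (fun x hx => ?_) zero_lt_one
  · exact hf.continuousOn.intervalIntegrable_of_Icc zero_le_one
  · have := hf.strictAntiOn ⟨hx.1.le, hx.2.le⟩ (right_mem_Icc.2 zero_le_one) hx.2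
    rwa [hf.map_one] at this

theorem integral_pseudoInv (hf : IsDecHomeo f) :
    ∫ t in (0:ℝ)..1, pseudoInv f t = ∫ t in (0:ℝ)..1, f t := by
  rw [intervalIntegral.integral_of_le zero_le_one, intervalIntegral.integral_of_le zero_le_one,
    ← integral_Icc_eq_integral_Ioc (f := f)]
  have hint : Integrable f (volume.restrict (Icc (0:ℝ) 1)) :=
    hf.continuousOn.integrableOn_Icc
  rw [hint.integral_eq_integral_Ioc_meas_le (M := 1)]
  · refine setIntegral_congr_fun measurableSet_Ioc fun t ht => ?_
    obtain ⟨v, hv, rfl⟩ := hf.exists_apply_eq (y := t) ⟨ht.1.le, ht.2⟩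
    have hset : {a | f v ≤ f a} ∩ Icc (0:ℝ) 1 = Icc 0 v := by
      rw [← setOf_le_apply_eq_Icc hf.strictAntiOn hv]
      ext a
      exact and_comm
    simp only [pseudoInv_apply hf.strictAntiOn hv]
    rw [measureReal_restrict_apply' measurableSet_Icc, hset, Real.volume_real_Icc_of_le hv.1,
      sub_zero]
  · filter_upwards [ae_restrict_mem measurableSet_Icc] with x hx using (hf.mem_Icc hx).1
  · filter_upwards [ae_restrict_mem measurableSet_Icc] with x hx using (hf.mem_Icc hx).2

theorem T_sub (f : ℝ → ℝ) (x y : ℝ) :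
    T f x - T f y = (∫ t in x..y, pseudoInv f t) / ∫ t in (0:ℝ)..1, f t := by
  rw [T, T, ← sub_div, ← intervalIntegral.integral_add_adjacent_intervals
    (pseudoInv_intervalIntegrable f x y) (pseudoInv_intervalIntegrable f y 1), add_sub_cancel_right]

theorem continuous_T (f : ℝ → ℝ) : Continuous (T f) := by
  have h0 : Continuous fun x => ∫ t in (1:ℝ)..x, pseudoInv f t :=
    intervalIntegral.continuous_primitive (fun a b => pseudoInv_intervalIntegrable f a b) 1
  have : T f = fun x => (-∫ t in (1:ℝ)..x, pseudoInv f t) / ∫ t in (0:ℝ)..1, f t := by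
    funext x
    rw [T, intervalIntegral.integral_symm]
  rw [this]
  exact h0.neg.div_const _

theorem isDecHomeo_T (hf : IsDecHomeo f) : IsDecHomeo (T f) where
  continuousOn := (continuous_T f).continuousOn
  strictAntiOn := by
    intro x hx y hy hxy
    rw [← sub_pos, T_sub]
    refine div_pos ?_ hf.integral_pos
    exact intervalIntegral.intervalIntegral_pos_of_pos_on (pseudoInv_intervalIntegrable f x y)
      (fun t ht => hf.pseudoInv_pos (hx.1.trans ht.1.le) (ht.2.trans_le hy.2)) hxy
  map_zero := by
    rw [T, hf.integral_pseudoInv, div_self hf.integral_pos.ne']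
  map_one := by
    rw [T, intervalIntegral.integral_same, zero_div]

end IsDecHomeo

namespace NoReturn

variable {f g : ℝ → ℝ}

/-- `NoReturn`, read off the inverse functions. -/
theorem pseudoInv_le (hfg : NoReturn f g) (hf : IsDecHomeo f) (hg : IsDecHomeo g)
    {l a x y z : ℝ} (hl : 0 < l) (ha : 0 < a) (hx : 0 ≤ x) (hxy : x < y) (hyz : y < z)
    (hz : z ≤ 1) (hlz : l * z ≤ 1) (h1 : a * pseudoInv f (l * x) < pseudoInv g x)
    (h2 : pseudoInv g y < a * pseudoInv f (l * y)) :
    pseudoInv g z ≤ a * pseudoInv f (l * z) := by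
  by_contra! h3
  have hmem : ∀ t, 0 ≤ t → t ≤ z → t ∈ Icc (0:ℝ) 1 ∧ l * t ∈ Icc (0:ℝ) 1 := fun t h0 ht =>
    ⟨⟨h0, ht.trans hz⟩, mul_nonneg hl.le h0, (mul_le_mul_of_nonneg_left ht hl.le).trans hlz⟩
  obtain ⟨hx1, hx2⟩ := hmem x hx (hxy.trans hyz).le
  obtain ⟨hy1, hy2⟩ := hmem y (hx.trans hxy.le) hyz.le
  obtain ⟨hz1, hz2⟩ := hmem z (hx.trans (hxy.trans hyz).le) le_rfl
  obtain ⟨u, hu, rfl⟩ := hg.exists_apply_eq hx1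
  obtain ⟨v, hv, rfl⟩ := hg.exists_apply_eq hy1
  obtain ⟨w, hw, rfl⟩ := hg.exists_apply_eq hz1
  obtain ⟨u', hu', eu⟩ := hf.exists_apply_eq hx2
  obtain ⟨v', hv', ev⟩ := hf.exists_apply_eq hy2
  obtain ⟨w', hw', ew⟩ := hf.exists_apply_eq hz2
  rw [← eu, pseudoInv_apply hf.strictAntiOn hu', pseudoInv_apply hg.strictAntiOn hu] at h1
  rw [← ev, pseudoInv_apply hf.strictAntiOn hv', pseudoInv_apply hg.strictAntiOn hv] at h2
  rw [← ew, pseudoInv_apply hf.strictAntiOn hw', pseudoInv_apply hg.strictAntiOn hw] at h3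
  have hvu : v' < u' := by
    rw [← hf.strictAntiOn.lt_iff_gt hu' hv', eu, ev]
    exact mul_lt_mul_of_pos_left hxy hl
  have hwv : w' < v' := by
    rw [← hf.strictAntiOn.lt_iff_gt hv' hw', ev, ew]
    exact mul_lt_mul_of_pos_left hyz hl
  have hvu_a := mul_lt_mul_of_pos_left hvu ha
  have hwv_a := mul_lt_mul_of_pos_left hwv ha
  have hw0 : 0 ≤ a * w' := mul_nonneg ha.le hw'.1
  have hau : a * u' ≤ 1 := h1.le.trans hu.2
  have key : ∀ s, a⁻¹ * (a * s) = s := fun s => inv_mul_cancel_left₀ ha.ne' s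
  have keyl : ∀ s, l⁻¹ * (l * s) = s := fun s => inv_mul_cancel_left₀ hl.ne' s
  have := hfg a⁻¹ l⁻¹ (a * w') (a * v') (a * u') (inv_pos.2 ha) (inv_pos.2 hl) hw0 hwv_a hvu_a hau
    (by rw [key]; exact hu'.2)
    (by rw [key, ew, keyl]; exact hg.strictAntiOn ⟨hw0, by linarith⟩ hw h3)
    (by rw [key, ev, keyl]; exact hg.strictAntiOn hv ⟨by linarith, by linarith⟩ h2)
  rw [key, eu, keyl] at this
  exact absurd (hg.strictAntiOn ⟨by linarith, hau⟩ hu h1) this.not_gt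

/-- An increment of `x ↦ m * T f (l * x) - T g x` is the integral of a difference of inverses. -/
theorem increment_eq (f g : ℝ → ℝ) {l : ℝ} (hl : 0 < l) (m x y : ℝ) :
    (m * T f (l * y) - T g y) - (m * T f (l * x) - T g x) =
      ∫ t in x..y, (pseudoInv g t / (∫ s in (0:ℝ)..1, g s) -
        m * l / (∫ s in (0:ℝ)..1, f s) * pseudoInv f (l * t)) := by
  have hi : IntervalIntegrable (fun t => pseudoInv f (l * t)) volume x y :=
    ((pseudoInv_antitone f).comp_monotone
      (monotone_mul_left_of_nonneg hl.le)).intervalIntegrable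
  rw [intervalIntegral.integral_sub ((pseudoInv_intervalIntegrable g x y).div_const _)
    (hi.const_mul _), intervalIntegral.integral_div, intervalIntegral.integral_const_mul,
    intervalIntegral.integral_comp_mul_left _ hl.ne', ← IsDecHomeo.T_sub]
  have h1 := IsDecHomeo.T_sub f (l * x) (l * y)
  have h2 : m * l / (∫ s in (0:ℝ)..1, f s) * (l⁻¹ • ∫ t in l * x..l * y, pseudoInv f t) =
      m * (T f (l * x) - T f (l * y)) := by
    rw [h1, smul_eq_mul]
    field_simp
  rw [h2]
  ring

theorem exists_lt_of_increment_pos (hf : IsDecHomeo f) (hg : IsDecHomeo g) {l m x y : ℝ}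
    (hl : 0 < l) (hxy : x ≤ y) (hlt : m * T f (l * x) - T g x < m * T f (l * y) - T g y) :
    ∃ t ∈ Icc x y, m * l * (∫ s in (0:ℝ)..1, g s) / (∫ s in (0:ℝ)..1, f s) *
      pseudoInv f (l * t) < pseudoInv g t := by
  by_contra! hcon
  have hF := hf.integral_pos
  have hG := hg.integral_pos
  have hinc := increment_eq f g hl m x y
  have : ∫ t in x..y, (pseudoInv g t / (∫ s in (0:ℝ)..1, g s) -
        m * l / (∫ s in (0:ℝ)..1, f s) * pseudoInv f (l * t)) ≤ 0 := by
    rw [← neg_nonneg, ← intervalIntegral.integral_neg]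
    refine intervalIntegral.integral_nonneg hxy fun t ht => ?_
    rw [neg_nonneg, sub_nonpos, div_le_iff₀ hG]
    refine (hcon t ht).trans (le_of_eq ?_)
    ring
  linarith

theorem exists_lt_of_increment_neg (hf : IsDecHomeo f) (hg : IsDecHomeo g) {l m x y : ℝ}
    (hl : 0 < l) (hxy : x ≤ y) (hlt : m * T f (l * y) - T g y < m * T f (l * x) - T g x) :
    ∃ t ∈ Icc x y, pseudoInv g t < m * l * (∫ s in (0:ℝ)..1, g s) /
      (∫ s in (0:ℝ)..1, f s) * pseudoInv f (l * t) := by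
  by_contra! hcon
  have hF := hf.integral_pos
  have hG := hg.integral_pos
  have hinc := increment_eq f g hl m x y
  have : 0 ≤ ∫ t in x..y, (pseudoInv g t / (∫ s in (0:ℝ)..1, g s) -
        m * l / (∫ s in (0:ℝ)..1, f s) * pseudoInv f (l * t)) := by
    refine intervalIntegral.integral_nonneg hxy fun t ht => ?_
    rw [sub_nonneg, le_div_iff₀ hG]
    refine le_trans (le_of_eq ?_) (hcon t ht)
    ring
  linarith

/-- If `m * T f (l * ·) - T g` increases from `x` to `y` and decreases from `y` to `z`, then the
inverse of `g` stays below the rescaled inverse of `f` from `z` on. -/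
theorem pseudoInv_le_of_up_down (hfg : NoReturn f g) (hf : IsDecHomeo f) (hg : IsDecHomeo g)
    {l m x y z t : ℝ} (hl : 0 < l) (hm : 0 < m) (hx : 0 ≤ x) (hxy : x ≤ y) (hyz : y ≤ z)
    (hzt : z ≤ t) (ht : t ≤ 1) (hlt : l * t ≤ 1)
    (hup : m * T f (l * x) - T g x < m * T f (l * y) - T g y)
    (hdown : m * T f (l * z) - T g z < m * T f (l * y) - T g y) :
    pseudoInv g t ≤ m * l * (∫ s in (0:ℝ)..1, g s) / (∫ s in (0:ℝ)..1, f s) *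
      pseudoInv f (l * t) := by
  obtain ⟨r, hr, hr'⟩ := exists_lt_of_increment_pos hf hg hl hxy hup
  obtain ⟨s, hs, hs'⟩ := exists_lt_of_increment_neg hf hg hl hyz hdown
  have hrs : r < s := lt_of_le_of_ne (hr.2.trans hs.1) (by rintro rfl; exact lt_asymm hr' hs')
  rcases (hs.2.trans hzt).eq_or_lt with rfl | hst
  · exact hs'.le
  · exact hfg.pseudoInv_le hf hg hl
      (div_pos (mul_pos (mul_pos hm hl) hg.integral_pos) hf.integral_pos)
      (hx.trans hr.1) hrs hst ht hlt hr' hs'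

/-- For `1 < l`, the function `m * T f (l * ·) - T g` cannot increase and then decrease. -/
theorem le_of_up_of_one_lt (hfg : NoReturn f g) (hf : IsDecHomeo f) (hg : IsDecHomeo g)
    {l m x y z : ℝ} (hl : 1 < l) (hm : 0 < m) (hx : 0 ≤ x) (hxy : x ≤ y) (hyz : y ≤ z)
    (hlz : l * z ≤ 1) (hup : m * T f (l * x) - T g x < m * T f (l * y) - T g y) :
    m * T f (l * y) - T g y ≤ m * T f (l * z) - T g z := by
  by_contra! hdown
  have hl0 : 0 < l := zero_lt_one.trans hl
  have hl1 : l⁻¹ < 1 := inv_lt_one_of_one_lt₀ hl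
  have hz : z ≤ l⁻¹ := by rwa [← mul_le_mul_iff_right₀ hl0, mul_inv_cancel₀ hl0.ne']
  have := hfg.pseudoInv_le_of_up_down hf hg hl0 hm hx hxy hyz hz hl1.le
    (mul_inv_cancel₀ hl0.ne').le hup hdown
  rw [mul_inv_cancel₀ hl0.ne', hf.pseudoInv_one, mul_zero] at this
  exact absurd (hg.pseudoInv_pos (inv_pos.2 hl0).le hl1) this.not_gt

theorem noReturn_T (hfg : NoReturn f g) (hf : IsDecHomeo f) (hg : IsDecHomeo g) :
    NoReturn (T f) (T g) := by
  intro l m x y z hl hm hx hxy hyz hz hlz h1 h2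
  by_contra! h3
  rcases le_or_gt l 1 with hl1 | hl1
  · have hend : 0 ≤ m * T f (l * 1) - T g 1 := by
      rw [hg.isDecHomeo_T.map_one, mul_one, sub_zero]
      exact mul_nonneg hm.le (hf.isDecHomeo_T.mem_Icc ⟨hl.le, hl1⟩).1
    obtain ⟨t, ht, ht'⟩ := exists_lt_of_increment_pos hf hg (m := m) hl hz (by linarith)
    exact absurd ht' (hfg.pseudoInv_le_of_up_down hf hg hl hm hx hxy.le hyz.le ht.1 ht.2
      (mul_le_one₀ hl1 (by linarith [ht.1]) ht.2) (by linarith) (by linarith)).not_gt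
  · have := hfg.le_of_up_of_one_lt hf hg hl1 hm hx hxy.le hyz.le hlz (by linarith)
    linarith

theorem T_le_T (hfg : NoReturn f g) (hf : IsDecHomeo f) (hg : IsDecHomeo g) {x : ℝ}
    (hx : x ∈ Icc (0:ℝ) 1) : T f x ≤ T g x := by
  by_contra! hlt
  have hx1 : x < 1 := by
    refine lt_of_le_of_ne hx.2 ?_
    rintro rfl
    rw [hf.isDecHomeo_T.map_one, hg.isDecHomeo_T.map_one] at hlt
    exact lt_irrefl _ hlt
  have hcont : Continuous fun l : ℝ => T f (l * x) :=
    (IsDecHomeo.continuous_T f).comp (continuous_mul_const x)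
  have hc1 : ∀ᶠ l in nhdsWithin (1:ℝ) (Ioi 1), T g x < T f (l * x) :=
    (hcont.continuousAt.eventually_const_lt (by simpa using hlt)).filter_mono nhdsWithin_le_nhds
  have hc2 : ∀ᶠ l in nhdsWithin (1:ℝ) (Ioi 1), l * x < 1 :=
    ((continuous_mul_const x).continuousAt.eventually_lt_const (by simpa using hx1)).filter_mono
      nhdsWithin_le_nhds
  obtain ⟨l, h1, h2, hl⟩ := (hc1.and (hc2.and self_mem_nhdsWithin)).exists
  have hl1 : 1 < l := hl
  have hl0 : 0 < l := zero_lt_one.trans hl1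
  have hxl : x ≤ l⁻¹ := by
    rw [← mul_le_mul_iff_right₀ hl0, mul_inv_cancel₀ hl0.ne']
    exact h2.le
  have := hfg.le_of_up_of_one_lt hf hg (m := 1) hl1 one_pos le_rfl hx.1 hxl
    (mul_inv_cancel₀ hl0.ne').le (by
      rw [mul_zero, hf.isDecHomeo_T.map_zero, hg.isDecHomeo_T.map_zero]
      linarith)
  rw [mul_inv_cancel₀ hl0.ne', hf.isDecHomeo_T.map_one] at this
  have := (hg.isDecHomeo_T.mem_Icc ⟨(inv_pos.2 hl0).le, (inv_lt_one_of_one_lt₀ hl1).le⟩).1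
  linarith

end NoReturn

theorem h_one_apply (x : ℝ) (hx : x ∈ Icc (0:ℝ) 1) : h 1 x = 1 - x := by
  have : ∫ t in x..(1:ℝ), pseudoInv (h 0) t = ∫ t in x..(1:ℝ), (1:ℝ) := by
    refine intervalIntegral.integral_congr fun t ht => ?_
    rw [uIcc_of_le hx.2] at ht
    have hset : {x : ℝ | x ∈ Icc (0:ℝ) 1 ∧ t ≤ h 0 x} = Icc 0 1 := by
      ext a
      exact ⟨fun ha => ha.1, fun ha => ⟨ha, ht.2⟩⟩
    simp only [pseudoInv, hset]
    exact csSup_Icc zero_le_one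
  change T (h 0) x = _
  rw [T, this]
  simp [h]

theorem isDecHomeo_h_one : IsDecHomeo (h 1) where
  continuousOn := (continuous_const.sub continuous_id).continuousOn.congr h_one_apply
  strictAntiOn := by
    intro x hx y hy hxy
    rw [h_one_apply x hx, h_one_apply y hy]
    linarith
  map_zero := by rw [h_one_apply 0 (by simp), sub_zero]
  map_one := by rw [h_one_apply 1 (by simp), sub_self]

theorem h_two_apply (x : ℝ) (hx : x ∈ Icc (0:ℝ) 1) : h 2 x = (1 - x) ^ 2 := by
  have h1 : ∫ t in x..(1:ℝ), pseudoInv (h 1) t = ∫ t in x..(1:ℝ), (1 - t) := by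
    refine intervalIntegral.integral_congr fun t ht => ?_
    rw [uIcc_of_le hx.2] at ht
    have hmem : 1 - t ∈ Icc (0:ℝ) 1 := ⟨by linarith [ht.2], by linarith [ht.1, hx.1]⟩
    have := pseudoInv_apply isDecHomeo_h_one.strictAntiOn hmem
    rwa [h_one_apply _ hmem, sub_sub_cancel] at this
  have h2 : ∫ t in (0:ℝ)..1, h 1 t = ∫ t in (0:ℝ)..1, (1 - t) := by
    refine intervalIntegral.integral_congr fun t ht => ?_
    rw [uIcc_of_le zero_le_one] at ht
    exact h_one_apply t ht
  change T (h 1) x = _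
  rw [T, h1, h2]
  simp only [intervalIntegral.integral_sub intervalIntegrable_const
    intervalIntegral.intervalIntegrable_id, integral_id, intervalIntegral.integral_const,
    smul_eq_mul]
  ring

theorem noReturn_h_two_h_one : NoReturn (h 2) (h 1) := by
  intro l m x y z hl hm hx hxy hyz hz hlz
  have hlx : l * x ≤ l * y := mul_le_mul_of_nonneg_left hxy.le hl.le
  have hly : l * y ≤ l * z := mul_le_mul_of_nonneg_left hyz.le hl.le
  have hlx0 : 0 ≤ l * x := mul_nonneg hl.le hx
  rw [h_two_apply (l * x) ⟨hlx0, by linarith⟩, h_two_apply (l * y) ⟨by linarith, by linarith⟩,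
    h_two_apply (l * z) ⟨by linarith, hlz⟩, h_one_apply x ⟨hx, by linarith⟩,
    h_one_apply y ⟨by linarith, by linarith⟩, h_one_apply z ⟨by linarith, hz⟩]
  intro h1 h2
  by_contra! h3
  have hconv : 0 ≤ m * l ^ 2 * ((y - x) * (z - y) * (z - x)) :=
    mul_nonneg (by positivity)
      (mul_nonneg (mul_nonneg (sub_nonneg.2 hxy.le) (sub_nonneg.2 hyz.le)) (by linarith))
  have e1 := mul_pos (sub_pos.2 h1) (sub_pos.2 hyz)
  have e2 := mul_pos (sub_pos.2 h2) (sub_pos.2 (hxy.trans hyz))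
  have e3 := mul_pos (sub_pos.2 h3) (sub_pos.2 hxy)
  nlinarith

theorem isDecHomeo_h_succ (n : ℕ) : IsDecHomeo (h (n + 1)) := by
  induction n with
  | zero => exact isDecHomeo_h_one
  | succ n ih => exact ih.isDecHomeo_T

theorem noReturn_h (n : ℕ) : NoReturn (h (n + 2)) (h (n + 1)) := by
  induction n with
  | zero => exact noReturn_h_two_h_one
  | succ n ih => exact ih.noReturn_T (isDecHomeo_h_succ (n + 1)) (isDecHomeo_h_succ n)

/-- The canonical iterates are pointwise decreasing on [0,1]. -/
theorem stmt12 : ∀ n : ℕ, ∀ x ∈ Icc (0:ℝ) 1, h (n + 1) x ≤ h n x := by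
  intro n x hx
  match n with
  | 0 =>
    rw [h_one_apply x hx]
    exact sub_le_self 1 hx.1
  | 1 =>
    rw [h_two_apply x hx, h_one_apply x hx]
    nlinarith [hx.1, hx.2]
  | n + 2 =>
    exact (noReturn_h n).T_le_T (isDecHomeo_h_succ (n + 1)) (isDecHomeo_h_succ n) hx
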